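/- Let P project onto an ((n,K))_D code Q, and Υ_S a random depolarizing error on qudits S. Then E_{Υ_S} E_{ψ∈Q}[⟨ψ|Υ_S†|ψ⟩⟨ψ|Υ_S|ψ⟩] = D^{−|S|}[K(K+1)]^{−1}( tr_S[(tr_{S'}P)²] + tr_{S'}[(tr_S P)²] ), and hence the transmission fidelity under error detection is F^d_S(P) = [K A_S'(P) + B_S'(P)] / [(K+1) B_S'(P)]. -/

import Mathlib

open Matrix MeasureTheory

noncomputable section

/-- Interleave a configuration on the qudits in `S` with one on the complement. -/
def glue {n : ℕ} {α : Type*} (S : Finset (Fin n)) (u : {i // i ∈ S} → α)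
    (v : {i // i ∉ S} → α) : Fin n → α :=
  fun i => if h : i ∈ S then u ⟨i, h⟩ else v ⟨i, h⟩

/-- Partial trace over the qudits indexed by `S` of an operator on `(ℂ^α)^{⊗n}`. -/
def ptr {n : ℕ} {α : Type*} [Fintype α] (S : Finset (Fin n))
    (M : Matrix (Fin n → α) (Fin n → α) ℂ) :
    Matrix ({i // i ∉ S} → α) ({i // i ∉ S} → α) ℂ :=
  fun v w => ∑ u : {i : Fin n // i ∈ S} → α, M (glue S u v) (glue S u w)


/-- `I_S ⊗ tr_S(A)`. -/
def idTensorPtr {n D : ℕ} (S : Finset (Fin n))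
    (A : Matrix (Fin n → Fin D) (Fin n → Fin D) ℂ) :
    Matrix (Fin n → Fin D) (Fin n → Fin D) ℂ :=
  fun f g =>
    if (fun i : {i // i ∈ S} => f i) = (fun i : {i // i ∈ S} => g i) then
      ptr S A (fun i : {i // i ∉ S} => f i) (fun i : {i // i ∉ S} => g i)
    else 0

/-- Rains enumerator `A_S'(P) = K⁻² tr_S[(tr_{S'}P)²]`. -/
def Arains {n D : ℕ} (K : ℕ) (S : Finset (Fin n))
    (P : Matrix (Fin n → Fin D) (Fin n → Fin D) ℂ) : ℂ :=
  (1 / (K : ℂ) ^ 2) * (ptr Sᶜ P * ptr Sᶜ P).trace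

/-- Rains enumerator `B_S'(P) = K⁻¹ tr_{S'}[(tr_S P)²]`. -/
def Brains {n D : ℕ} (K : ℕ) (S : Finset (Fin n))
    (P : Matrix (Fin n → Fin D) (Fin n → Fin D) ℂ) : ℂ :=
  (1 / (K : ℂ)) * (ptr S P * ptr S P).trace

theorem eq_zero_of_quartic_diag_eq_zero {V : Type*} [AddCommGroup V] [Module ℂ V]
    (T : V → V → V → V → ℂ)
    (add₁ : ∀ x x' y z w, T (x + x') y z w = T x y z w + T x' y z w)
    (add₃ : ∀ x y z z' w, T x y (z + z') w = T x y z w + T x y z' w)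
    (smul₁ : ∀ (t : ℂ) x y z w, T (t • x) y z w = star t * T x y z w)
    (smul₃ : ∀ (t : ℂ) x y z w, T x y (t • z) w = t * T x y z w)
    (symm₁ : ∀ x y z w, T x y z w = T y x z w)
    (symm₂ : ∀ x y z w, T x y z w = T x y w z)
    (diag : ∀ x, T x x x x = 0) (x y z w : V) : T x y z w = 0 := by
  have add₂ : ∀ x y y' z w, T x (y + y') z w = T x y z w + T x y' z w := fun x y y' z w => by
    rw [symm₁, add₁, symm₁ y, symm₁ y']
  have add₄ : ∀ x y z w w', T x y z (w + w') = T x y z w + T x y z w' := fun x y z w w' => by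
    rw [symm₂, add₃, symm₂ x y w, symm₂ x y w']
  have smul₂ : ∀ (t : ℂ) x y z w, T x (t • y) z w = star t * T x y z w := fun t x y z w => by
    rw [symm₁, smul₁, symm₁ y]
  have smul₄ : ∀ (t : ℂ) x y z w, T x y z (t • w) = t * T x y z w := fun t x y z w => by
    rw [symm₂, smul₃, symm₂ x y w]
  have key : ∀ x y, T x x y y + T y y x x = 0 := fun x y => by
    have h (t : ℂ) := diag (x + t • y)
    simp only [add₁, add₂, add₃, add₄, smul₁, smul₂, smul₃, smul₄] at h
    have h1 := h 1
    have h2 := h (-1)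
    have h3 := h Complex.I
    have h4 := h (-Complex.I)
    simp only [star_one, star_neg, Complex.star_def, Complex.conj_I] at h1 h2 h3 h4
    have hI := Complex.I_sq
    have hI4 := Complex.I_pow_four
    ring_nf at h1 h2 h3 h4
    have hI3 : Complex.I ^ 3 = -Complex.I := by rw [pow_succ, hI]; ring
    simp only [hI, hI3, hI4] at h3 h4
    linear_combination (h1 + h2 - h3 - h4) / 4
  have key' : ∀ x y, T x x y y = 0 := fun x y => by
    have h1 := key x y
    have h2 := key x ((1 + Complex.I) • y)
    simp only [smul₁, smul₂, smul₃, smul₄, star_add, star_one, Complex.star_def,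
      Complex.conj_I] at h2
    have hI := Complex.I_sq
    have : Complex.I * T x x y y = 0 := by
      linear_combination (h2 + 2 * Complex.I * h1 - hI * (T x x y y + T y y x x)) / 4
    exact (mul_eq_zero.mp this).resolve_left Complex.I_ne_zero
  have key'' : ∀ x y z, T x y z z = 0 := fun x y z => by
    have h := key' (x + y) z
    simp only [add₁, add₂] at h
    linear_combination (h - key' x z - key' y z + symm₁ x y z z) / 2
  have h := key'' x y (z + w)
  simp only [add₃, add₄] at h
  linear_combination (h - key'' x y z - key'' x y w + symm₂ x y z w) / 2

theorem star_dotProduct_self_eq_ofReal {ι : Type*} [Fintype ι] (v : ι → ℂ) :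
    star v ⬝ᵥ v = ((∑ i, Complex.normSq (v i) : ℝ) : ℂ) := by
  simp [dotProduct, Complex.normSq_eq_conj_mul_self]

theorem star_star_dotProduct {ι : Type*} [Fintype ι] (v w : ι → ℂ) :
    star (star v ⬝ᵥ w) = star w ⬝ᵥ v := by
  simp [dotProduct, mul_comm]

theorem star_dotProduct_self_eq_zero {ι : Type*} [Fintype ι] {v : ι → ℂ}
    (h : star v ⬝ᵥ v = 0) : v = 0 := by
  rw [star_dotProduct_self_eq_ofReal, Complex.ofReal_eq_zero,
    Finset.sum_eq_zero_iff_of_nonneg fun i _ => Complex.normSq_nonneg _] at h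
  exact funext fun i => Complex.normSq_eq_zero.mp (h i (Finset.mem_univ i))

theorem exists_unitary_mulVec_eq {ι : Type*} [Fintype ι] [DecidableEq ι]
    (Q : Submodule ℂ (ι → ℂ)) {u v : ι → ℂ} (hu : u ∈ Q) (hv : v ∈ Q)
    (hnorm : star u ⬝ᵥ u = star v ⬝ᵥ v) (hreal : star u ⬝ᵥ v = star v ⬝ᵥ u) :
    ∃ U ∈ Matrix.unitaryGroup ι ℂ, (∀ x ∈ Q, U.mulVec x ∈ Q) ∧ Uᴴ = U ∧ U.mulVec u = v := by
  by_cases huv : u = v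
  · exact ⟨1, one_mem _, by simp, by simp, by simp [huv]⟩
  set w := u - v with hw
  have hwQ : w ∈ Q := Q.sub_mem hu hv
  have hs : star w ⬝ᵥ w ≠ 0 := by
    intro h
    exact huv (sub_eq_zero.mp (star_dotProduct_self_eq_zero h))
  set s := star w ⬝ᵥ w with hsdef
  have hsstar : star s = s := star_star_dotProduct w w
  have hsu : s = 2 * (star w ⬝ᵥ u) := by
    simp only [hsdef, hw, star_sub, sub_dotProduct, dotProduct_sub]
    linear_combination -hnorm -hreal
  have hherm : (1 - (2 / s) • vecMulVec w (star w))ᴴ = 1 - (2 / s) • vecMulVec w (star w) := by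
    simp [conjTranspose_smul, conjTranspose_vecMulVec, hsstar]
  refine ⟨1 - (2 / s) • vecMulVec w (star w), ?_, ?_, hherm, ?_⟩
  · rw [Matrix.mem_unitaryGroup_iff, star_eq_conjTranspose, hherm]
    have : vecMulVec w (star w) * vecMulVec w (star w) = s • vecMulVec w (star w) := by
      rw [vecMulVec_mul_vecMulVec]
      ext; simp [vecMulVec_apply, hsdef]; ring
    simp only [sub_mul, mul_sub, one_mul, mul_one, smul_mul_assoc, mul_smul_comm, this, smul_smul]
    have : 2 / s * s = 2 := by field_simp
    rw [this]
    module
  · intro x hx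
    rw [sub_mulVec, one_mulVec, smul_mulVec, vecMulVec_mulVec]
    refine Q.sub_mem hx (Q.smul_mem _ ?_)
    have := Q.smul_mem (star w ⬝ᵥ x) hwQ
    simpa using this
  · rw [sub_mulVec, one_mulVec, smul_mulVec, vecMulVec_mulVec]
    have : 2 / s * (star w ⬝ᵥ u) = 1 := by
      field_simp; exact hsu.symm
    ext i
    have h2 := congrArg (· * w i) this
    simp [hw] at h2 ⊢
    linear_combination -h2

theorem exists_phase_real {ι : Type*} [Fintype ι] (u v : ι → ℂ) :
    ∃ e : ℂ, star e * e = 1 ∧ star u ⬝ᵥ (e • v) = star (e • v) ⬝ᵥ u := by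
  set z := star u ⬝ᵥ v with hz
  have hz' : star v ⬝ᵥ u = star z := (star_star_dotProduct u v).symm
  by_cases h : z = 0
  · exact ⟨1, by simp, by simp [hz', ← hz, h]⟩
  have hn : (‖z‖ : ℂ) ≠ 0 := by simpa using h
  have hzz : star z * z = (‖z‖ : ℂ) ^ 2 := Complex.conj_mul' z
  have hstar : star (‖z‖ : ℂ) = ‖z‖ := Complex.conj_ofReal _
  refine ⟨star z / ‖z‖, ?_, ?_⟩
  · rw [star_div₀, hstar, star_star]
    field_simp
    linear_combination hzz
  · rw [star_smul, dotProduct_smul, smul_dotProduct, hz', ← hz, star_div₀, hstar, star_star]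
    simp only [smul_eq_mul]
    ring

theorem integral_sum_sum {ι Ω : Type*} [Fintype ι] [MeasurableSpace Ω] {μ : Measure Ω}
    {F : ι → ι → Ω → ℂ} (hF : ∀ a b, Integrable (F a b) μ) :
    ∫ x, ∑ a, ∑ b, F a b x ∂μ = ∑ a, ∑ b, ∫ x, F a b x ∂μ := by
  rw [integral_finsetSum _ fun a _ => integrable_finsetSum _ fun b _ => hF a b]
  exact Finset.sum_congr rfl fun a _ => integral_finsetSum _ fun b _ => hF a b

theorem integral_sum_sum_sum_sum {ι Ω : Type*} [Fintype ι] [MeasurableSpace Ω] {μ : Measure Ω}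
    {F : ι → ι → ι → ι → Ω → ℂ} (hF : ∀ a b c d, Integrable (F a b c d) μ) :
    ∫ x, ∑ a, ∑ b, ∑ c, ∑ d, F a b c d x ∂μ = ∑ a, ∑ b, ∑ c, ∑ d, ∫ x, F a b c d x ∂μ := by
  rw [integral_sum_sum fun a b =>
    integrable_finsetSum _ fun c _ => integrable_finsetSum _ fun d _ => hF a b c d]
  exact Finset.sum_congr rfl fun a _ => Finset.sum_congr rfl fun b _ =>
    integral_sum_sum fun c d => hF a b c d

section Moments

variable {ι : Type*} [Fintype ι] {Q : Submodule ℂ (ι → ℂ)}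
  {P : Matrix ι ι ℂ} {μ : Measure (ι → ℂ)}

theorem integral_overlap_eq_of_unitary [DecidableEq ι]
    (hinv : ∀ U ∈ Matrix.unitaryGroup ι ℂ, (∀ v ∈ Q, U.mulVec v ∈ Q) → μ.map U.mulVec = μ)
    {u v : ι → ℂ} (hu : u ∈ Q) (hv : v ∈ Q)
    (hnorm : star u ⬝ᵥ u = star v ⬝ᵥ v) (hreal : star u ⬝ᵥ v = star v ⬝ᵥ u) :
    ∫ ψ, (star u ⬝ᵥ ψ) ^ 2 * (star ψ ⬝ᵥ u) ^ 2 ∂μ =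
      ∫ ψ, (star v ⬝ᵥ ψ) ^ 2 * (star ψ ⬝ᵥ v) ^ 2 ∂μ := by
  obtain ⟨U, hU, hUQ, hUh, rfl⟩ := exists_unitary_mulVec_eq Q hu hv hnorm hreal
  conv_lhs => rw [← hinv U hU hUQ]
  rw [integral_map (by fun_prop) (by unfold dotProduct; fun_prop)]
  congr 1
  funext ψ
  rw [star_mulVec, star_mulVec, hUh, ← dotProduct_mulVec, ← dotProduct_mulVec]

theorem exists_integral_overlap_eq [DecidableEq ι]
    (hinv : ∀ U ∈ Matrix.unitaryGroup ι ℂ, (∀ v ∈ Q, U.mulVec v ∈ Q) → μ.map U.mulVec = μ)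
    (hQ : Q ≠ ⊥) :
    ∃ c : ℂ, ∀ v ∈ Q, ∫ ψ, (star v ⬝ᵥ ψ) ^ 2 * (star ψ ⬝ᵥ v) ^ 2 ∂μ = c * (star v ⬝ᵥ v) ^ 2 := by
  obtain ⟨u, hu, hu0⟩ := Q.exists_mem_ne_zero_of_ne_bot hQ
  have hn : star u ⬝ᵥ u ≠ 0 := fun h => hu0 (star_dotProduct_self_eq_zero h)
  refine ⟨(∫ ψ, (star u ⬝ᵥ ψ) ^ 2 * (star ψ ⬝ᵥ u) ^ 2 ∂μ) / (star u ⬝ᵥ u) ^ 2, fun v hv => ?_⟩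
  obtain ⟨e, he, hreal⟩ := exists_phase_real u v
  set a : ℝ := ∑ i, Complex.normSq (u i)
  set b : ℝ := ∑ i, Complex.normSq (v i)
  have ha : star u ⬝ᵥ u = a := star_dotProduct_self_eq_ofReal u
  have hb : star v ⬝ᵥ v = b := star_dotProduct_self_eq_ofReal v
  have ha0 : 0 ≤ a := Finset.sum_nonneg fun i _ => Complex.normSq_nonneg _
  have hb0 : 0 ≤ b := Finset.sum_nonneg fun i _ => Complex.normSq_nonneg _
  have hane : (a : ℂ) ≠ 0 := ha ▸ hn
  set r : ℝ := √(b / a)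
  have hr : (r : ℂ) ^ 2 = b / a := by
    exact_mod_cast Real.sq_sqrt (div_nonneg hb0 ha0)
  have hrs : star (r : ℂ) = r := Complex.conj_ofReal _
  have scale (t : ℂ) (x : ι → ℂ) :
      ∫ ψ, (star (t • x) ⬝ᵥ ψ) ^ 2 * (star ψ ⬝ᵥ (t • x)) ^ 2 ∂μ =
        (star t * t) ^ 2 * ∫ ψ, (star x ⬝ᵥ ψ) ^ 2 * (star ψ ⬝ᵥ x) ^ 2 ∂μ := by
    rw [← integral_const_mul]
    congr 1
    funext ψ
    simp only [star_smul, smul_dotProduct, dotProduct_smul, smul_eq_mul]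
    ring
  have h := integral_overlap_eq_of_unitary (μ := μ) hinv (Q.smul_mem (r : ℂ) hu) (Q.smul_mem e hv)
    (by
      simp only [star_smul, smul_dotProduct, dotProduct_smul, smul_eq_mul, ha, hb, hrs]
      have : (r : ℂ) ^ 2 * a = b := by rw [hr]; field_simp
      linear_combination this - b * he)
    (by
      rw [star_smul (r : ℂ), smul_dotProduct, hreal, hrs]
      exact (dotProduct_smul _ _ _).symm)
  rw [scale, scale, he, hrs, ← sq, hr] at h
  rw [ha, hb]
  rw [one_pow, one_mul] at h
  rw [← h]
  field_simp

theorem trace_eq_finrank [DecidableEq ι] (hPidem : P * P = P)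
    (hPrange : ∀ v : ι → ℂ, v ∈ Q ↔ P.mulVec v = v) : P.trace = Module.finrank ℂ Q := by
  have h : LinearMap.IsProj Q (Matrix.toLin' P) :=
    ⟨fun x => by rw [hPrange]; simp [hPidem], fun x hx => by simpa using (hPrange x).mp hx⟩
  rw [← h.trace, Matrix.trace_toLin'_eq]

theorem integrable_of_norm_le_one [IsFiniteMeasure μ]
    (hsupp : ∀ᵐ ψ ∂μ, ψ ∈ Q ∧ star ψ ⬝ᵥ ψ = 1) {F : (ι → ℂ) → ℂ} (hF : Measurable F)
    (hbound : ∀ ψ : ι → ℂ, (∀ i, ‖ψ i‖ ≤ 1) → ‖F ψ‖ ≤ 1) : Integrable F μ := by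
  refine Integrable.of_bound hF.aestronglyMeasurable 1 ?_
  filter_upwards [hsupp] with ψ hψ
  refine hbound ψ fun i => ?_
  have h := hψ.2
  rw [star_dotProduct_self_eq_ofReal] at h
  have h' : ∑ i, Complex.normSq (ψ i) = 1 := by exact_mod_cast h
  have h2 := Finset.single_le_sum (f := fun i => Complex.normSq (ψ i))
    (fun i _ => Complex.normSq_nonneg _) (Finset.mem_univ i)
  rw [h', Complex.normSq_eq_norm_sq] at h2
  exact (sq_le_one_iff₀ (norm_nonneg _)).mp h2

theorem integrable_quartic [IsFiniteMeasure μ]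
    (hsupp : ∀ᵐ ψ ∂μ, ψ ∈ Q ∧ star ψ ⬝ᵥ ψ = 1) (a b c d : ι) :
    Integrable (fun ψ : ι → ℂ => ψ a * ψ b * star (ψ c) * star (ψ d)) μ := by
  refine integrable_of_norm_le_one hsupp (by fun_prop) fun ψ h => ?_
  simp only [norm_mul, norm_star]
  exact mul_le_one₀ (mul_le_one₀ (mul_le_one₀ (h a) (norm_nonneg _) (h b)) (norm_nonneg _) (h c))
    (norm_nonneg _) (h d)

theorem integrable_quadratic [IsFiniteMeasure μ]
    (hsupp : ∀ᵐ ψ ∂μ, ψ ∈ Q ∧ star ψ ⬝ᵥ ψ = 1) (a b : ι) :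
    Integrable (fun ψ : ι → ℂ => ψ a * star (ψ b)) μ := by
  refine integrable_of_norm_le_one hsupp (by fun_prop) fun ψ h => ?_
  simp only [norm_mul, norm_star]
  exact mul_le_one₀ (h a) (norm_nonneg _) (h b)

theorem dotProduct_sq_mul_dotProduct_sq (v ψ : ι → ℂ) :
    (star v ⬝ᵥ ψ) ^ 2 * (star ψ ⬝ᵥ v) ^ 2 = ∑ a, ∑ b, ∑ c, ∑ d,
      star (v a) * star (v b) * v c * v d * (ψ a * ψ b * star (ψ c) * star (ψ d)) := by
  rw [mul_comm]
  simp only [sq, dotProduct, Pi.star_apply]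
  simp only [Finset.mul_sum, Finset.sum_mul]
  refine Finset.sum_congr rfl fun a _ => Finset.sum_congr rfl fun b _ =>
    Finset.sum_congr rfl fun c _ => Finset.sum_congr rfl fun d _ => by ring

theorem dotProduct_mulVec_sq (P : Matrix ι ι ℂ) (v : ι → ℂ) :
    (star v ⬝ᵥ P.mulVec v) ^ 2 = ∑ a, ∑ b, ∑ c, ∑ d,
      star (v a) * star (v b) * v c * v d * (P a c * P b d) := by
  simp only [dotProduct, mulVec, Pi.star_apply, sq]
  rw [Finset.sum_mul_sum]
  refine Finset.sum_congr rfl fun a _ => Finset.sum_congr rfl fun b _ => ?_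
  rw [mul_mul_mul_comm, Finset.sum_mul_sum]
  simp only [Finset.mul_sum]
  refine Finset.sum_congr rfl fun c _ => Finset.sum_congr rfl fun d _ => by ring

theorem sum_moment_eq_one [IsProbabilityMeasure μ]
    (hsupp : ∀ᵐ ψ ∂μ, ψ ∈ Q ∧ star ψ ⬝ᵥ ψ = 1) :
    ∑ a, ∑ b, ∫ ψ : ι → ℂ, ψ a * ψ b * star (ψ a) * star (ψ b) ∂μ = 1 := by
  have h : ∀ᵐ ψ ∂μ, ∑ a, ∑ b, ψ a * ψ b * star (ψ a) * star (ψ b) = 1 := by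
    filter_upwards [hsupp] with ψ hψ
    have : (star ψ ⬝ᵥ ψ) * (star ψ ⬝ᵥ ψ) = 1 := by rw [hψ.2, one_mul]
    rw [← this]
    simp only [dotProduct, Pi.star_apply, Finset.sum_mul_sum]
    refine Finset.sum_congr rfl fun a _ => Finset.sum_congr rfl fun b _ => by ring
  have h1 := integral_congr_ae h
  have hint (a b : ι) := integrable_quartic hsupp a b a b
  rw [integral_sum_sum hint] at h1
  simpa using h1

theorem integral_quartic_eq [DecidableEq ι] [IsProbabilityMeasure μ]
    (hPherm : P.IsHermitian) (hPidem : P * P = P)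
    (hPrange : ∀ v : ι → ℂ, v ∈ Q ↔ P.mulVec v = v) (hQ : Q ≠ ⊥)
    (hsupp : ∀ᵐ ψ ∂μ, ψ ∈ Q ∧ star ψ ⬝ᵥ ψ = 1)
    (hinv : ∀ U ∈ Matrix.unitaryGroup ι ℂ, (∀ v ∈ Q, U.mulVec v ∈ Q) → μ.map U.mulVec = μ)
    (a b c d : ι) :
    ∫ ψ, ψ a * ψ b * star (ψ c) * star (ψ d) ∂μ =
      (P a c * P b d + P a d * P b c) /
        ((Module.finrank ℂ Q : ℂ) * ((Module.finrank ℂ Q : ℂ) + 1)) := by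
  obtain ⟨k, hk⟩ := exists_integral_overlap_eq hinv hQ
  set m : ι → ι → ι → ι → ℂ := fun a b c d => ∫ ψ, ψ a * ψ b * star (ψ c) * star (ψ d) ∂μ with hm
  have hdiag (v : ι → ℂ) :
      ∑ a, ∑ b, ∑ c, ∑ d, star (v a) * star (v b) * v c * v d * m a b c d =
        k * (star v ⬝ᵥ P.mulVec v) ^ 2 := by
    have hPv : P.mulVec v ∈ Q := by rw [hPrange, mulVec_mulVec, hPidem]
    have h := hk _ hPv
    rw [star_mulVec, hPherm, ← dotProduct_mulVec (star v), mulVec_mulVec, hPidem] at h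
    rw [← h]
    have hae : ∀ᵐ ψ ∂μ, (star v ᵥ* P ⬝ᵥ ψ) ^ 2 * (star ψ ⬝ᵥ P *ᵥ v) ^ 2 =
        (star v ⬝ᵥ ψ) ^ 2 * (star ψ ⬝ᵥ v) ^ 2 := by
      filter_upwards [hsupp] with ψ hψ
      have hψP := (hPrange ψ).mp hψ.1
      have : star ψ ᵥ* P = star ψ := by
        conv_rhs => rw [← hψP, star_mulVec, hPherm]
      rw [← dotProduct_mulVec, hψP, dotProduct_mulVec, this]
    rw [integral_congr_ae hae]
    simp only [dotProduct_sq_mul_dotProduct_sq]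
    rw [integral_sum_sum_sum_sum fun a b c d => (integrable_quartic hsupp a b c d).const_mul _]
    simp only [integral_const_mul, hm]
  have hform (a b c d : ι) : m a b c d = k / 2 * (P a c * P b d + P a d * P b c) := by
    set τ : ι → ι → ι → ι → ℂ := fun a b c d =>
      m a b c d - k / 2 * (P a c * P b d + P a d * P b c) with hτ
    have hτ₁ : ∀ a b c d, τ a b c d = τ b a c d := fun a b c d => by
      have : m a b c d = m b a c d := by
        refine integral_congr_ae (.of_forall fun ψ => ?_)
        ring
      simp only [hτ, this]
      ring
    have hτ₂ : ∀ a b c d, τ a b c d = τ a b d c := fun a b c d => by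
      have : m a b c d = m a b d c := by
        refine integral_congr_ae (.of_forall fun ψ => ?_)
        ring
      simp only [hτ, this]
      ring
    have hT := eq_zero_of_quartic_diag_eq_zero (V := ι → ℂ)
      (fun x y z w => ∑ a, ∑ b, ∑ c, ∑ d, star (x a) * star (y b) * z c * w d * τ a b c d)
      (by intros; simp only [Pi.add_apply, star_add, add_mul, Finset.sum_add_distrib])
      (by intros; simp only [Pi.add_apply, mul_add, add_mul, Finset.sum_add_distrib])
      (by
        intros
        simp only [Pi.smul_apply, smul_eq_mul, star_mul', Finset.mul_sum, mul_assoc])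
      (by
        intros
        simp only [Pi.smul_apply, smul_eq_mul, Finset.mul_sum, mul_assoc, mul_left_comm])
      (by
        intro x y z w
        rw [Finset.sum_comm]
        simp only [mul_comm (star (x _)), hτ₁])
      (by
        intro x y z w
        refine Finset.sum_congr rfl fun a _ => Finset.sum_congr rfl fun b _ => ?_
        rw [Finset.sum_comm]
        refine Finset.sum_congr rfl fun c _ => Finset.sum_congr rfl fun d _ => ?_
        rw [hτ₂]
        ring)
      (by
        intro x
        have h1 := dotProduct_mulVec_sq P x
        have h2 : (star x ⬝ᵥ P.mulVec x) ^ 2 = ∑ a, ∑ b, ∑ c, ∑ d,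
            star (x a) * star (x b) * x c * x d * (P a d * P b c) := by
          rw [h1]
          refine Finset.sum_congr rfl fun a _ => Finset.sum_congr rfl fun b _ => ?_
          rw [Finset.sum_comm]
          refine Finset.sum_congr rfl fun c _ => Finset.sum_congr rfl fun d _ => by ring
        have h3 : ∀ a b c d, star (x a) * star (x b) * x c * x d * τ a b c d =
            star (x a) * star (x b) * x c * x d * m a b c d -
            (k / 2 * (star (x a) * star (x b) * x c * x d * (P a c * P b d)) +
            k / 2 * (star (x a) * star (x b) * x c * x d * (P a d * P b c))) := by
          intros
          simp only [hτ]
          ring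
        simp only [h3, Finset.sum_sub_distrib, Finset.sum_add_distrib, ← Finset.mul_sum]
        rw [hdiag, ← h1, ← h2]
        ring)
      (Pi.single a 1) (Pi.single b 1) (Pi.single c 1) (Pi.single d 1)
    simp [Pi.single_apply, apply_ite, ite_mul] at hT
    exact sub_eq_zero.mp hT
  have hnorm : k / 2 * ((Module.finrank ℂ Q : ℂ) * ((Module.finrank ℂ Q : ℂ) + 1)) = 1 := by
    have h : ∑ a, ∑ b, m a b a b = 1 := sum_moment_eq_one hsupp
    have h1 : ∑ a, P a a = P.trace := rfl
    have h2 : ∑ a, ∑ b, P a b * P b a = P.trace := by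
      conv_rhs => rw [← hPidem]
      rfl
    simp only [hform, mul_add, Finset.sum_add_distrib, ← Finset.mul_sum, ← Finset.sum_mul] at h
    rw [h1, h2, trace_eq_finrank hPidem hPrange] at h
    linear_combination h
  change m a b c d = _
  rw [hform, eq_div_iff (right_ne_zero_of_mul (hnorm ▸ one_ne_zero))]
  linear_combination (P a c * P b d + P a d * P b c) * hnorm

theorem integral_quadratic_eq [DecidableEq ι] [IsProbabilityMeasure μ]
    (hPherm : P.IsHermitian) (hPidem : P * P = P)
    (hPrange : ∀ v : ι → ℂ, v ∈ Q ↔ P.mulVec v = v) (hQ : Q ≠ ⊥)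
    (hsupp : ∀ᵐ ψ ∂μ, ψ ∈ Q ∧ star ψ ⬝ᵥ ψ = 1)
    (hinv : ∀ U ∈ Matrix.unitaryGroup ι ℂ, (∀ v ∈ Q, U.mulVec v ∈ Q) → μ.map U.mulVec = μ)
    (a b : ι) :
    ∫ ψ, ψ a * star (ψ b) ∂μ = P a b / (Module.finrank ℂ Q : ℂ) := by
  have hae : ∀ᵐ ψ ∂μ, ψ a * star (ψ b) = ∑ c, ψ a * ψ c * star (ψ b) * star (ψ c) := by
    filter_upwards [hsupp] with ψ hψ
    calc ψ a * star (ψ b) = ψ a * star (ψ b) * (star ψ ⬝ᵥ ψ) := by rw [hψ.2, mul_one]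
      _ = _ := by
        rw [dotProduct, Finset.mul_sum]
        exact Finset.sum_congr rfl fun c _ => by rw [Pi.star_apply]; ring
  rw [integral_congr_ae hae, integral_finsetSum _ fun c _ => integrable_quartic hsupp a c b c]
  simp only [integral_quartic_eq hPherm hPidem hPrange hQ hsupp hinv]
  have h1 : ∑ c, P c c = P.trace := rfl
  have h2 : ∑ c, P a c * P c b = P a b := by
    conv_rhs => rw [← hPidem]
    rfl
  rw [← Finset.sum_div, Finset.sum_add_distrib, ← Finset.mul_sum, h1, h2,
    trace_eq_finrank hPidem hPrange]
  have hK : (Module.finrank ℂ Q : ℂ) ≠ 0 := by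
    simpa [Submodule.finrank_eq_zero] using hQ
  have hK1 : (Module.finrank ℂ Q : ℂ) + 1 ≠ 0 := Nat.cast_add_one_ne_zero _
  field_simp

end Moments

section Qudits

variable {n : ℕ} {α : Type*}

theorem sum_eq_sum_glue [Fintype α] (S : Finset (Fin n)) (F : (Fin n → α) → ℂ) :
    ∑ f, F f = ∑ u : {i // i ∈ S} → α, ∑ v : {i // i ∉ S} → α, F (glue S u v) := by
  rw [← (Equiv.piEquivPiSubtypeProd (· ∈ S) fun _ => α).symm.sum_comp, Fintype.sum_prod_type]
  rfl

theorem glue_compl (S : Finset (Fin n)) (u : {i // i ∈ Sᶜ} → α) (v : {i // i ∉ Sᶜ} → α) :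
    glue Sᶜ u v = glue S (fun i => v ⟨i, by simp⟩) (fun i => u ⟨i, by simpa using i.2⟩) := by
  funext i
  by_cases h : i ∈ S <;> simp [glue, h]

theorem trace_ptr_mul_ptr [Fintype α] (S : Finset (Fin n)) (M : Matrix (Fin n → α) (Fin n → α) ℂ) :
    (ptr S M * ptr S M).trace = ∑ y, ∑ z, ∑ x, ∑ w,
      M (glue S x y) (glue S x z) * M (glue S w z) (glue S w y) := by
  simp only [Matrix.trace, Matrix.diag, Matrix.mul_apply, ptr, Finset.sum_mul_sum]

theorem trace_ptr_compl_mul_ptr_compl [Fintype α] (S : Finset (Fin n))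
    (M : Matrix (Fin n → α) (Fin n → α) ℂ) :
    (ptr Sᶜ M * ptr Sᶜ M).trace = ∑ x, ∑ w, ∑ y, ∑ z,
      M (glue S x y) (glue S w y) * M (glue S w z) (glue S x z) := by
  let e₁ : ({i // i ∉ Sᶜ} → α) ≃ ({i // i ∈ S} → α) :=
    (Equiv.subtypeEquivRight fun i => by simp).arrowCongr (Equiv.refl α)
  let e₂ : ({i // i ∈ Sᶜ} → α) ≃ ({i // i ∉ S} → α) :=
    (Equiv.subtypeEquivRight fun i => by simp).arrowCongr (Equiv.refl α)
  rw [trace_ptr_mul_ptr]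
  simp only [glue_compl]
  exact Fintype.sum_equiv e₁ _ _ fun x => Fintype.sum_equiv e₁ _ _ fun w =>
    Fintype.sum_equiv e₂ _ _ fun y => Fintype.sum_equiv e₂ _ _ fun z => rfl

theorem idTensorPtr_glue {D : ℕ} (S : Finset (Fin n))
    (A : Matrix (Fin n → Fin D) (Fin n → Fin D) ℂ) (u u' : {i // i ∈ S} → Fin D)
    (v v' : {i // i ∉ S} → Fin D) :
    idTensorPtr S A (glue S u v) (glue S u' v') = if u = u' then ptr S A v v' else 0 := by
  have hu (u : {i // i ∈ S} → Fin D) (v : {i // i ∉ S} → Fin D) :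
      (fun i : {i // i ∈ S} => glue S u v i) = u := funext fun i => by simp [glue, i.2]
  have hv (u : {i // i ∈ S} → Fin D) (v : {i // i ∉ S} → Fin D) :
      (fun i : {i // i ∉ S} => glue S u v i) = v := funext fun i => by simp [glue, i.2]
  simp only [idTensorPtr, hu, hv]

theorem sum_sum_idTensorPtr {D : ℕ} (S : Finset (Fin n))
    (X : (Fin n → Fin D) → (Fin n → Fin D) → Matrix (Fin n → Fin D) (Fin n → Fin D) ℂ) :
    ∑ a, ∑ b, idTensorPtr S (X a b) a b =
      ∑ w, ∑ y, ∑ z, ∑ x, X (glue S w y) (glue S w z) (glue S x y) (glue S x z) := by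
  rw [sum_eq_sum_glue S]
  refine Finset.sum_congr rfl fun w _ => Finset.sum_congr rfl fun y _ => ?_
  rw [sum_eq_sum_glue S]
  simp only [idTensorPtr_glue]
  rw [Finset.sum_eq_single w (fun u _ hu => by simp [hu.symm]) (by simp)]
  simp [ptr]

theorem sum_sum_mul_idTensorPtr_single {D : ℕ} (S : Finset (Fin n))
    (X : Matrix (Fin n → Fin D) (Fin n → Fin D) ℂ) (a b : Fin n → Fin D) :
    ∑ f, ∑ f', X f f' * idTensorPtr S (Matrix.single f f' (1 : ℂ)) a b = idTensorPtr S X a b := by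
  unfold idTensorPtr
  split_ifs with h
  · simp only [ptr, Finset.mul_sum]
    rw [Finset.sum_congr rfl fun f _ => Finset.sum_comm, Finset.sum_comm]
    refine Finset.sum_congr rfl fun u _ => ?_
    simp [Matrix.single_apply, ite_and]
  · simp

end Qudits

section RandomError

variable {ι Ω : Type*} [Fintype ι] [MeasurableSpace Ω] {ν : Measure Ω} {Υ : Ω → Matrix ι ι ℂ}

theorem integral_expectation_mul [DecidableEq ι]
    (hInt : ∀ f g f' g', Integrable (fun ω => (starRingEnd ℂ) (Υ ω f g) * Υ ω f' g') ν)
    (ψ : ι → ℂ) :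
    ∫ ω, (star ψ ⬝ᵥ (Υ ω)ᴴ.mulVec ψ) * (star ψ ⬝ᵥ (Υ ω).mulVec ψ) ∂ν =
      ∑ a, ∑ b, ∑ f, ∑ f', (ψ f * ψ b * star (ψ a) * star (ψ f')) *
        ∫ ω, ((Υ ω)ᴴ * Matrix.single f f' (1 : ℂ) * Υ ω) a b ∂ν := by
  have hexp (ω : Ω) : (star ψ ⬝ᵥ (Υ ω)ᴴ.mulVec ψ) * (star ψ ⬝ᵥ (Υ ω).mulVec ψ) =
      ∑ a, ∑ b, ∑ f, ∑ f', (ψ f * ψ b * star (ψ a) * star (ψ f')) *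
        ((starRingEnd ℂ) (Υ ω f a) * Υ ω f' b) := by
    rw [dotProduct_mulVec (star ψ) (Υ ω) ψ]
    simp only [dotProduct, mulVec, vecMul, Finset.sum_mul_sum, Pi.star_apply, conjTranspose_apply]
    refine Finset.sum_congr rfl fun a _ => Finset.sum_congr rfl fun b _ => ?_
    simp only [Finset.mul_sum, Finset.sum_mul]
    rw [Finset.sum_comm]
    refine Finset.sum_congr rfl fun f _ => Finset.sum_congr rfl fun f' _ => ?_
    simp only [Complex.star_def]
    ring
  have hsingle (f f' a b : ι) (ω : Ω) : ((Υ ω)ᴴ * Matrix.single f f' (1 : ℂ) * Υ ω) a b =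
      (starRingEnd ℂ) (Υ ω f a) * Υ ω f' b := by
    simp [Matrix.mul_apply, Matrix.single_apply, ite_and]
  simp only [hexp, hsingle]
  rw [integral_sum_sum_sum_sum fun a b f f' => (hInt f a f' b).const_mul _]
  simp only [integral_const_mul]

theorem integral_expectation_conj
    (hInt : ∀ f g f' g', Integrable (fun ω => (starRingEnd ℂ) (Υ ω f g) * Υ ω f' g') ν)
    (A : Matrix ι ι ℂ) (ψ : ι → ℂ) :
    ∫ ω, star ψ ⬝ᵥ ((Υ ω)ᴴ * A * Υ ω).mulVec ψ ∂ν =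
      ∑ a, ∑ b, (ψ b * star (ψ a)) * ∫ ω, ((Υ ω)ᴴ * A * Υ ω) a b ∂ν := by
  have hentry (a b : ι) : Integrable (fun ω => ((Υ ω)ᴴ * A * Υ ω) a b) ν := by
    simp only [Matrix.mul_apply, Finset.sum_mul, conjTranspose_apply]
    refine integrable_finsetSum _ fun f' _ => integrable_finsetSum _ fun f _ => ?_
    refine ((hInt f a f' b).const_mul (A f f')).congr (.of_forall fun ω => ?_)
    simp only [Complex.star_def]
    ring
  have hexp (ω : Ω) : star ψ ⬝ᵥ ((Υ ω)ᴴ * A * Υ ω).mulVec ψ =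
      ∑ a, ∑ b, (ψ b * star (ψ a)) * ((Υ ω)ᴴ * A * Υ ω) a b := by
    simp only [dotProduct, mulVec, Finset.mul_sum, Pi.star_apply]
    refine Finset.sum_congr rfl fun a _ => Finset.sum_congr rfl fun b _ => by ring
  simp only [hexp]
  rw [integral_sum_sum fun a b => (hentry a b).const_mul _]
  simp only [integral_const_mul]

end RandomError

/-- For the projector `P` of an `((n,K))_D` code `Q` and a random
depolarizing error `Υ_S` on the qudits in `S`:
`E_{Υ_S} E_ψ[⟨ψ|Υ_S†|ψ⟩⟨ψ|Υ_S|ψ⟩]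
  = D^{−|S|}[K(K+1)]^{−1}(tr_S[(tr_{S'}P)²] + tr_{S'}[(tr_S P)²])`,
and hence the transmission fidelity under error detection (the ratio of this quantity
to the transmission rate `E_{Υ_S}E_ψ[⟨ψ|Υ_S†PΥ_S|ψ⟩]`) equals
`[K·A_S'(P) + B_S'(P)] / [(K+1)·B_S'(P)]`. -/
theorem stmt_12 (n D K : ℕ) (hD : 2 ≤ D) (hK : 1 ≤ K) (S : Finset (Fin n))
    (Q : Submodule ℂ ((Fin n → Fin D) → ℂ))
    (hQK : Module.finrank ℂ Q = K)
    (P : Matrix (Fin n → Fin D) (Fin n → Fin D) ℂ)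
    (hPherm : P.IsHermitian) (hPidem : P * P = P)
    (hPrange : ∀ v : (Fin n → Fin D) → ℂ, v ∈ Q ↔ P.mulVec v = v)
    (μ : Measure ((Fin n → Fin D) → ℂ)) [IsProbabilityMeasure μ]
    (hsupp : ∀ᵐ ψ ∂μ, ψ ∈ Q ∧ star ψ ⬝ᵥ ψ = 1)
    (hinv : ∀ U : Matrix (Fin n → Fin D) (Fin n → Fin D) ℂ,
      U ∈ Matrix.unitaryGroup (Fin n → Fin D) ℂ →
      (∀ v ∈ Q, U.mulVec v ∈ Q) → μ.map U.mulVec = μ)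
    (Ω : Type) [MeasurableSpace Ω] (ν : Measure Ω) [IsProbabilityMeasure ν]
    (Υ : Ω → Matrix (Fin n → Fin D) (Fin n → Fin D) ℂ)
    (hΥInt : ∀ f g f' g' : Fin n → Fin D,
      Integrable (fun ω => (starRingEnd ℂ) (Υ ω f g) * Υ ω f' g') ν)
    (hΥdep : ∀ (A : Matrix (Fin n → Fin D) (Fin n → Fin D) ℂ) f g,
      ∫ ω, ((Υ ω)ᴴ * A * Υ ω) f g ∂ν = idTensorPtr S A f g / (D : ℂ) ^ S.card) :
    (∫ ψ, ∫ ω, (star ψ ⬝ᵥ (Υ ω)ᴴ.mulVec ψ) * (star ψ ⬝ᵥ (Υ ω).mulVec ψ) ∂ν ∂μ =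
        ((D : ℂ) ^ S.card * ((K : ℂ) * ((K : ℂ) + 1)))⁻¹ *
          ((ptr Sᶜ P * ptr Sᶜ P).trace + (ptr S P * ptr S P).trace)) ∧
      (∫ ψ, ∫ ω, (star ψ ⬝ᵥ (Υ ω)ᴴ.mulVec ψ) * (star ψ ⬝ᵥ (Υ ω).mulVec ψ) ∂ν ∂μ) /
          (∫ ψ, ∫ ω, star ψ ⬝ᵥ ((Υ ω)ᴴ * P * Υ ω).mulVec ψ ∂ν ∂μ) =
        ((K : ℂ) * Arains K S P + Brains K S P) / (((K : ℂ) + 1) * Brains K S P) := by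
  have hQ : Q ≠ ⊥ := by
    rintro rfl
    rw [finrank_bot] at hQK
    omega
  have hKne : (K : ℂ) ≠ 0 := by exact_mod_cast (by omega : K ≠ 0)
  have hK1 : (K : ℂ) + 1 ≠ 0 := Nat.cast_add_one_ne_zero K
  have hDne : (D : ℂ) ^ S.card ≠ 0 := pow_ne_zero _ (by exact_mod_cast (by omega : D ≠ 0))
  have hquart := integral_quartic_eq hPherm hPidem hPrange hQ hsupp hinv
  have hquad := integral_quadratic_eq hPherm hPidem hPrange hQ hsupp hinv
  rw [hQK] at hquart hquad
  have hnum : ∫ ψ, ∫ ω, (star ψ ⬝ᵥ (Υ ω)ᴴ.mulVec ψ) * (star ψ ⬝ᵥ (Υ ω).mulVec ψ) ∂ν ∂μ =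
      ((D : ℂ) ^ S.card * ((K : ℂ) * ((K : ℂ) + 1)))⁻¹ *
        ((ptr Sᶜ P * ptr Sᶜ P).trace + (ptr S P * ptr S P).trace) := by
    simp only [integral_expectation_mul hΥInt, hΥdep]
    rw [integral_sum_sum_sum_sum fun a b f f' => (integrable_quartic hsupp f b a f').mul_const _]
    simp only [integral_mul_const, hquart]
    have hterm : ∀ a b f f', (P f a * P b f' + P f f' * P b a) / ((K : ℂ) * ((K : ℂ) + 1)) *
        (idTensorPtr S (Matrix.single f f' (1 : ℂ)) a b / (D : ℂ) ^ S.card) =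
        ((D : ℂ) ^ S.card * ((K : ℂ) * ((K : ℂ) + 1)))⁻¹ *
          ((P f a * P b f' + P f f' * P b a) * idTensorPtr S (Matrix.single f f' (1 : ℂ)) a b) := by
      intros
      field_simp
    simp only [hterm, ← Finset.mul_sum]
    congr 1
    have h := fun a b => sum_sum_mul_idTensorPtr_single S
      (Matrix.of fun f f' => P f a * P b f' + P f f' * P b a) a b
    simp only [Matrix.of_apply] at h
    simp only [h]
    rw [sum_sum_idTensorPtr S fun a b => Matrix.of fun f f' => P f a * P b f' + P f f' * P b a]
    simp only [Matrix.of_apply, Finset.sum_add_distrib]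
    rw [trace_ptr_compl_mul_ptr_compl, trace_ptr_mul_ptr]
    congr 1
    · rw [Finset.sum_congr rfl fun w _ => Finset.sum_congr rfl fun y _ => Finset.sum_comm,
        Finset.sum_congr rfl fun w _ => Finset.sum_comm, Finset.sum_comm]
    · rw [Finset.sum_comm]
      refine Finset.sum_congr rfl fun y _ => ?_
      rw [Finset.sum_comm]
      exact Finset.sum_congr rfl fun z _ => Finset.sum_comm
  have hden : ∫ ψ, ∫ ω, star ψ ⬝ᵥ ((Υ ω)ᴴ * P * Υ ω).mulVec ψ ∂ν ∂μ =
      ((D : ℂ) ^ S.card * (K : ℂ))⁻¹ * (ptr S P * ptr S P).trace := by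
    simp only [integral_expectation_conj hΥInt, hΥdep]
    rw [integral_sum_sum fun a b => (integrable_quadratic hsupp b a).mul_const _]
    simp only [integral_mul_const, hquad]
    have hterm : ∀ a b, P b a / (K : ℂ) * (idTensorPtr S P a b / (D : ℂ) ^ S.card) =
        ((D : ℂ) ^ S.card * (K : ℂ))⁻¹ * idTensorPtr S (P b a • P) a b := by
      intro a b
      have : idTensorPtr S (P b a • P) a b = P b a * idTensorPtr S P a b := by
        simp [idTensorPtr, ptr, Finset.mul_sum]
      rw [this]
      field_simp
    simp only [hterm, ← Finset.mul_sum]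
    congr 1
    rw [sum_sum_idTensorPtr S fun a b => P b a • P, trace_ptr_mul_ptr, Finset.sum_comm]
    refine Finset.sum_congr rfl fun y _ => ?_
    rw [Finset.sum_comm]
    refine Finset.sum_congr rfl fun z _ => ?_
    rw [Finset.sum_comm]
    refine Finset.sum_congr rfl fun x _ => Finset.sum_congr rfl fun w _ => ?_
    simp [mul_comm]
  refine ⟨hnum, ?_⟩
  rw [hnum, hden, Arains, Brains]
  rcases eq_or_ne (ptr S P * ptr S P).trace 0 with h | h
  · simp [h]
  · field_simp

end
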